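/- Let k be an integer with 2 ≤ k and 2k ≤ n, ε ∈ {1,−1}, and 1 ≤ i ≤ n−1. Define the linear form g_{i,k,ε} on 𝔭_i by g_{i,k,ε}(x) = trace(X_{k,ε}·ν_i(x)), where ν_i(x) is the matrix agreeing with x on the upper-right i×(n−i) block and zero elsewhere, and set 𝔟_{i,k,ε} = { Y ∈ 𝔭_i : trace(X_{k,ε}·[Y,Z]) = 0 for all Z ∈ 𝔫_i }. Then: (a) the stabilizer { W ∈ 𝔭_i : g_{i,k,ε}([W,Z]) = 0 for all Z ∈ 𝔭_i } is contained in 𝔟_{i,k,ε}; and (b) 𝔟_{i,k,ε} is coisotropic with respect to the alternating form (X,Y) ↦ g_{i,k,ε}([X,Y]) on 𝔭_i, i.e. every W ∈ 𝔭_i with g_{i,k,ε}([W,Y]) = 0 for all Y ∈ 𝔟_{i,k,ε} belongs to 𝔟_{i,k,ε}. -/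

import Mathlib

open Matrix

/-- The n×n real matrix unit `E_{a,b}` (1-based indices). -/
noncomputable def Ematrix (n a b : ℕ) : Matrix (Fin n) (Fin n) ℝ :=
  fun s t => if (s : ℕ) + 1 = a ∧ (t : ℕ) + 1 = b then 1 else 0

/-- `X_{k,ε} = Σ_{i=1}^{k−1} E_{n+1−i,i} + ε·E_{n+1−k,k}`. -/
noncomputable def Xmat (n k : ℕ) (ε : ℝ) : Matrix (Fin n) (Fin n) ℝ :=
  (∑ i ∈ Finset.Icc 1 (k - 1), Ematrix n (n + 1 - i) i) + ε • Ematrix n (n + 1 - k) k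

/-- The maximal parabolic subalgebra `𝔭_i ⊆ sl_n(ℝ)`, as a set. -/
def pSet (n i : ℕ) : Set (Matrix (Fin n) (Fin n) ℝ) :=
  {x | x.trace = 0 ∧ ∀ s t : Fin n, i ≤ (s : ℕ) → (t : ℕ) < i → x s t = 0}

/-- The abelian nilradical `𝔫_i` of `𝔭_i`: matrices supported in the
upper-right i×(n−i) block. -/
def nSet (n i : ℕ) : Set (Matrix (Fin n) (Fin n) ℝ) :=
  {x | ∀ s t : Fin n, ¬((s : ℕ) < i ∧ i ≤ (t : ℕ)) → x s t = 0}

/-- `ν_i(x)`: the matrix agreeing with `x` on the upper-right i×(n−i) block and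
zero elsewhere. -/
def nu (n i : ℕ) (x : Matrix (Fin n) (Fin n) ℝ) : Matrix (Fin n) (Fin n) ℝ :=
  fun s t => if (s : ℕ) < i ∧ i ≤ (t : ℕ) then x s t else 0

/-- The linear form `g_{i,k,ε}` on `𝔭_i`. -/
noncomputable def gForm (n i k : ℕ) (ε : ℝ) (x : Matrix (Fin n) (Fin n) ℝ) : ℝ :=
  (Xmat n k ε * nu n i x).trace

/-- `𝔟_{i,k,ε} = { Y ∈ 𝔭_i : trace(X_{k,ε}·[Y,Z]) = 0 for all Z ∈ 𝔫_i }`. -/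
def bSet (n i k : ℕ) (ε : ℝ) : Set (Matrix (Fin n) (Fin n) ℝ) :=
  {Y | Y ∈ pSet n i ∧ ∀ Z ∈ nSet n i, (Xmat n k ε * (Y * Z - Z * Y)).trace = 0}

theorem mul_mem_nSet {n i : ℕ} {W Z : Matrix (Fin n) (Fin n) ℝ} (hW : W ∈ pSet n i)
    (hZ : Z ∈ nSet n i) : W * Z ∈ nSet n i := by
  intro s t hst
  rw [Matrix.mul_apply]
  refine Finset.sum_eq_zero fun r _ => ?_
  by_cases hr : (r : ℕ) < i ∧ i ≤ (t : ℕ)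
  · exact mul_eq_zero_of_left (hW.2 s r (by omega) hr.1) _
  · exact mul_eq_zero_of_right _ (hZ r t hr)

theorem nSet_mul_mem_nSet {n i : ℕ} {W Z : Matrix (Fin n) (Fin n) ℝ} (hW : W ∈ pSet n i)
    (hZ : Z ∈ nSet n i) : Z * W ∈ nSet n i := by
  intro s t hst
  rw [Matrix.mul_apply]
  refine Finset.sum_eq_zero fun r _ => ?_
  by_cases hr : (s : ℕ) < i ∧ i ≤ (r : ℕ)
  · exact mul_eq_zero_of_right _ (hW.2 r t hr.2 (by omega))
  · exact mul_eq_zero_of_left (hZ s r hr) _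

theorem nu_eq_self {n i : ℕ} {x : Matrix (Fin n) (Fin n) ℝ} (hx : x ∈ nSet n i) :
    nu n i x = x := by
  ext s t
  by_cases h : (s : ℕ) < i ∧ i ≤ (t : ℕ)
  · exact if_pos h
  · exact (if_neg h).trans (hx s t h).symm

theorem gForm_commutator {n i : ℕ} (k : ℕ) (ε : ℝ) {W Z : Matrix (Fin n) (Fin n) ℝ}
    (hW : W ∈ pSet n i) (hZ : Z ∈ nSet n i) :
    gForm n i k ε (W * Z - Z * W) = (Xmat n k ε * (W * Z - Z * W)).trace := by
  have h : W * Z - Z * W ∈ nSet n i := fun s t hst => by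
    rw [Matrix.sub_apply, mul_mem_nSet hW hZ s t hst, nSet_mul_mem_nSet hW hZ s t hst, sub_zero]
  rw [gForm, nu_eq_self h]

theorem nSet_subset_pSet (n i : ℕ) : nSet n i ⊆ pSet n i := fun Z hZ =>
  ⟨Finset.sum_eq_zero fun s _ => hZ s s (by omega), fun s t hs _ => hZ s t (by omega)⟩

theorem mul_eq_zero_of_mem_nSet {n i : ℕ} {Y Z : Matrix (Fin n) (Fin n) ℝ}
    (hY : Y ∈ nSet n i) (hZ : Z ∈ nSet n i) : Y * Z = 0 := by
  ext s t
  rw [Matrix.mul_apply, Matrix.zero_apply]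
  refine Finset.sum_eq_zero fun r _ => ?_
  by_cases hr : (r : ℕ) < i
  · exact mul_eq_zero_of_left (hY s r (by omega)) _
  · exact mul_eq_zero_of_right _ (hZ r t (by omega))

theorem nSet_subset_bSet (n i k : ℕ) (ε : ℝ) : nSet n i ⊆ bSet n i k ε := fun Y hY =>
  ⟨nSet_subset_pSet n i hY, fun Z hZ => by
    simp [mul_eq_zero_of_mem_nSet hY hZ, mul_eq_zero_of_mem_nSet hZ hY]⟩

theorem b_strongly_unipotent (n : ℕ) (hn : 4 ≤ n) (k : ℕ) (hk : 2 ≤ k)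
    (hkn : 2 * k ≤ n) (ε : ℝ) (hε : ε = 1 ∨ ε = -1)
    (i : ℕ) (hi1 : 1 ≤ i) (hi2 : i ≤ n - 1) :
    {W | W ∈ pSet n i ∧ ∀ Z ∈ pSet n i, gForm n i k ε (W * Z - Z * W) = 0} ⊆
        bSet n i k ε ∧
    ∀ W ∈ pSet n i,
      (∀ Y ∈ bSet n i k ε, gForm n i k ε (W * Y - Y * W) = 0) → W ∈ bSet n i k ε :=
  ⟨fun _ hW => ⟨hW.1, fun Z hZ =>
      (gForm_commutator k ε hW.1 hZ).symm.trans (hW.2 Z (nSet_subset_pSet n i hZ))⟩,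
    fun _ hW h => ⟨hW, fun Z hZ =>
      (gForm_commutator k ε hW hZ).symm.trans (h Z (nSet_subset_bSet n i k ε hZ))⟩⟩
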